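/- Let m ≥ 3 be an odd integer. Then: (a) for every real β with 0 < β < 1 − 1/m, the equation ((1+t)^(m−1) + (1−t)^(m−1)) / ((1+t)^m + (1−t)^m) = 1 − β has exactly one root t in (0, ∞); and (b) for every real β with 1 − 1/m ≤ β < 1, this equation has no root t in (0, ∞), i.e., φ_m(t) > 1/m for all t > 0. -/

import Mathlib

open Filter Topology

theorem pow_four_mul_sub_add_pos {a b : ℝ} (hab : 0 < a + b) (hba : 0 < a - b) (k : ℕ) :
    0 < a ^ (4 * (k + 1)) - b ^ (4 * (k + 1))
      + (2 * (k : ℝ) + 2) * (a ^ 2 - b ^ 2) * (a * b) ^ (2 * k + 1) := by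
  have hd : 0 < a ^ 2 - b ^ 2 := by nlinarith
  induction k with
  | zero =>
    have h : 0 < (a ^ 2 - b ^ 2) * (a + b) ^ 2 := by positivity
    refine h.trans_eq ?_
    push_cast
    ring
  | succ k ih =>
    have hlt : (-b) ^ (2 * k + 3) < a ^ (2 * k + 3) :=
      Odd.strictMono_pow ⟨k + 1, by ring⟩ (by linarith)
    rw [Odd.neg_pow ⟨k + 1, by ring⟩] at hlt
    have hs : 0 < a ^ (2 * k + 3) + b ^ (2 * k + 3) := by linarith
    have h₁ : 0 < (a ^ 2 - b ^ 2) * (a ^ (2 * k + 3) + b ^ (2 * k + 3)) ^ 2 := by positivity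
    have h₂ := mul_nonneg (sq_nonneg (a * b)) ih.le
    have h := add_pos_of_pos_of_nonneg h₁ h₂
    refine h.trans_eq ?_
    push_cast
    ring

/-- With `n = 2k + 2`, the quotient `((1+t)^n - (1-t)^n) / ((1+t)^n + (1-t)^n)`. -/
noncomputable def powRatio (k : ℕ) (t : ℝ) : ℝ :=
  ((1 + t) ^ (2 * k + 2) - (1 - t) ^ (2 * k + 2)) / ((1 + t) ^ (2 * k + 2) + (1 - t) ^ (2 * k + 2))

theorem one_add_pow_add_one_sub_pow_pos (k : ℕ) (t : ℝ) :
    0 < (1 + t) ^ (2 * k + 2) + (1 - t) ^ (2 * k + 2) := by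
  have he : Even (2 * k + 2) := ⟨k + 1, by ring⟩
  rcases eq_or_ne (1 + t) 0 with h | h
  · exact add_pos_of_nonneg_of_pos (he.pow_nonneg _) (he.pow_pos (by intro h'; linarith))
  · exact add_pos_of_pos_of_nonneg (he.pow_pos h) (he.pow_nonneg _)

theorem hasDerivAt_powRatio (k : ℕ) (t : ℝ) :
    HasDerivAt (powRatio k) (4 * (2 * k + 2) * ((1 + t) * (1 - t)) ^ (2 * k + 1) /
      ((1 + t) ^ (2 * k + 2) + (1 - t) ^ (2 * k + 2)) ^ 2) t := by
  have hA := ((hasDerivAt_id' t).const_add 1).fun_pow (2 * k + 2)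
  have hB := ((hasDerivAt_id' t).const_sub 1).fun_pow (2 * k + 2)
  refine ((hA.sub hB).div (hA.add hB) (one_add_pow_add_one_sub_pow_pos k t).ne').congr_deriv ?_
  congr 1
  simp only [Pi.add_apply, Pi.sub_apply, show 2 * k + 2 - 1 = 2 * k + 1 by omega, mul_pow]
  push_cast
  ring

theorem hasDerivAt_mul_powRatio (k : ℕ) (t : ℝ) :
    HasDerivAt (fun t ↦ t * powRatio k t)
      (((1 + t) ^ (4 * (k + 1)) - (1 - t) ^ (4 * (k + 1))
      + (2 * (k : ℝ) + 2) * ((1 + t) ^ 2 - (1 - t) ^ 2) * ((1 + t) * (1 - t)) ^ (2 * k + 1)) /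
      ((1 + t) ^ (2 * k + 2) + (1 - t) ^ (2 * k + 2)) ^ 2) t := by
  refine ((hasDerivAt_id' t).mul (hasDerivAt_powRatio k t)).congr_deriv ?_
  have h := (one_add_pow_add_one_sub_pow_pos k t).ne'
  rw [powRatio]
  generalize ((1 + t) * (1 - t)) ^ (2 * k + 1) = c
  rw [show 4 * (k + 1) = (2 * k + 2) * 2 by ring, pow_mul, pow_mul]
  field_simp
  ring

theorem strictMonoOn_mul_powRatio (k : ℕ) :
    StrictMonoOn (fun t ↦ t * powRatio k t) (Set.Ici 0) := by
  refine strictMonoOn_of_deriv_pos (convex_Ici 0)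
    (fun t _ ↦ (hasDerivAt_mul_powRatio k t).continuousAt.continuousWithinAt) fun t ht ↦ ?_
  rw [interior_Ici, Set.mem_Ioi] at ht
  rw [(hasDerivAt_mul_powRatio k t).deriv]
  exact div_pos (pow_four_mul_sub_add_pos (by linarith) (by linarith) k)
    (pow_pos (one_add_pow_add_one_sub_pow_pos k t) 2)

theorem powRatio_inv (k : ℕ) {t : ℝ} (ht : t ≠ 0) : powRatio k t⁻¹ = powRatio k t := by
  have he : Even (2 * k + 2) := ⟨k + 1, by ring⟩
  have h₁ : (1 + t⁻¹) = (1 + t) * t⁻¹ := by field_simp; ring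
  have h₂ : (1 - t⁻¹) ^ (2 * k + 2) = (1 - t) ^ (2 * k + 2) * t⁻¹ ^ (2 * k + 2) := by
    rw [← mul_pow, ← he.neg_pow]
    congr 1
    field_simp
    ring
  rw [powRatio, powRatio, h₁, h₂, mul_pow, ← sub_mul, ← add_mul]
  exact mul_div_mul_right _ _ (pow_ne_zero _ (inv_ne_zero ht))

theorem tendsto_mul_powRatio (k : ℕ) :
    Tendsto (fun t ↦ t * powRatio k t) atTop (𝓝 (2 * k + 2)) := by
  have h := hasDerivAt_iff_tendsto_slope.1 (hasDerivAt_powRatio k 0)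
  have h' := h.comp ((tendsto_inv_atTop_nhdsGT_zero (𝕜 := ℝ)).mono_right
    (nhdsWithin_mono _ fun x (hx : 0 < x) ↦ hx.ne'))
  convert h'.congr' ?_ using 2
  · norm_num
  · filter_upwards [eventually_gt_atTop 0] with t ht
    simp [slope_def_field, powRatio_inv k ht.ne', show powRatio k 0 = 0 by simp [powRatio], mul_comm]

theorem mul_powRatio_lt (k : ℕ) {t : ℝ} (ht : 0 < t) : t * powRatio k t < 2 * k + 2 := by
  have hlt : t * powRatio k t < (t + 1) * powRatio k (t + 1) :=
    strictMonoOn_mul_powRatio k ht.le (by simp; linarith) (by linarith)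
  refine hlt.trans_le (ge_of_tendsto (tendsto_mul_powRatio k) ?_)
  filter_upwards [eventually_ge_atTop (t + 1)] with s hs
  exact (strictMonoOn_mul_powRatio k).monotoneOn (by simp; linarith) (by simp; linarith) hs

theorem exists_mul_powRatio_eq (k : ℕ) {c : ℝ} (hc : 0 < c) (hck : c < 2 * k + 2) :
    ∃ t, 0 < t ∧ t * powRatio k t = c := by
  obtain ⟨T, hT, hT₀⟩ := (((tendsto_mul_powRatio k).eventually_const_lt hck).and
    (eventually_gt_atTop 0)).exists
  obtain ⟨t, ht, h⟩ := intermediate_value_Icc hT₀.le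
    (fun t _ ↦ (hasDerivAt_mul_powRatio k t).continuousAt.continuousWithinAt)
    (show c ∈ Set.Icc _ _ from ⟨by simpa using hc.le, hT.le⟩)
  refine ⟨t, lt_of_le_of_ne ht.1 ?_, h⟩
  rintro rfl
  simp at h
  exact hc.ne h

theorem mul_powRatio_pos (k : ℕ) {t : ℝ} (ht : 0 < t) : 0 < t * powRatio k t := by
  simpa using strictMonoOn_mul_powRatio k Set.self_mem_Ici ht.le ht

theorem div_eq_inv_one_add_mul_powRatio (k : ℕ) (t : ℝ) :
    ((1 + t) ^ (2 * k + 2) + (1 - t) ^ (2 * k + 2)) /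
      ((1 + t) ^ (2 * k + 3) + (1 - t) ^ (2 * k + 3)) = (1 + t * powRatio k t)⁻¹ := by
  have h := (one_add_pow_add_one_sub_pow_pos k t).ne'
  rw [← inv_div, powRatio]
  congr 1
  field_simp
  ring

/-- For odd `m ≥ 3`: (a) for `β ∈ (0, 1 - 1/m)` the equation `φ_m(t) = 1 - β` has exactly one
root `t ∈ (0,∞)`; (b) for `β ∈ [1 - 1/m, 1)` it has no root in `(0,∞)`, i.e.
`φ_m(t) > 1/m` for all `t > 0`. -/
theorem stmt_5 (m : ℕ) (hm : 3 ≤ m) (hmo : Odd m) :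
    (∀ β : ℝ, 0 < β → β < 1 - 1 / (m : ℝ) →
        ∃! t : ℝ, 0 < t ∧
          ((1 + t) ^ (m - 1) + (1 - t) ^ (m - 1)) / ((1 + t) ^ m + (1 - t) ^ m) = 1 - β) ∧
    (∀ β : ℝ, 1 - 1 / (m : ℝ) ≤ β → β < 1 →
        ¬ ∃ t : ℝ, 0 < t ∧
          ((1 + t) ^ (m - 1) + (1 - t) ^ (m - 1)) / ((1 + t) ^ m + (1 - t) ^ m) = 1 - β) ∧
    (∀ t : ℝ, 0 < t →
        1 / (m : ℝ) < ((1 + t) ^ (m - 1) + (1 - t) ^ (m - 1)) / ((1 + t) ^ m + (1 - t) ^ m)) := by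
  obtain ⟨k, rfl⟩ : ∃ k, m = 2 * k + 3 := by
    obtain ⟨j, rfl⟩ := hmo
    exact ⟨j - 1, by omega⟩
  simp only [show 2 * k + 3 - 1 = 2 * k + 2 by omega, div_eq_inv_one_add_mul_powRatio]
  push_cast
  have hlow : ∀ t : ℝ, 0 < t → 1 / (2 * (k : ℝ) + 3) < (1 + t * powRatio k t)⁻¹ := by
    intro t ht
    have h₁ := mul_powRatio_pos k ht
    have h₂ := mul_powRatio_lt k ht
    rw [← one_div]
    exact one_div_lt_one_div_of_lt (by linarith) (by linarith)
  refine ⟨fun β hβ hβm ↦ ?_, ?_, hlow⟩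
  · have hβ' : 1 / (2 * (k : ℝ) + 3) < 1 - β := by linarith
    have hpos : 0 < 1 - β := lt_trans (by positivity) hβ'
    have hinv : (1 - β)⁻¹ < 2 * k + 3 := by
      rw [inv_lt_comm₀ hpos (by positivity), ← one_div]
      exact hβ'
    have hone : 1 < (1 - β)⁻¹ := (one_lt_inv₀ hpos).2 (by linarith)
    obtain ⟨t, ht, h⟩ := exists_mul_powRatio_eq k (c := (1 - β)⁻¹ - 1) (by linarith) (by linarith)
    refine ⟨t, ⟨ht, by rw [h, add_sub_cancel, inv_inv]⟩, fun s ⟨hs, hs'⟩ ↦ ?_⟩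
    refine (strictMonoOn_mul_powRatio k).injOn hs.le ht.le ?_
    rw [← hs', inv_inv] at h
    simp only [h]
    ring
  · rintro β hβ - ⟨t, ht, h⟩
    have := hlow t ht
    linarith
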